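/- arXiv:1906.05821 — 9 statements merged into one kernel-verified Lean document; each statement's English description precedes it below -/
import Mathlib

section
/- For every point (x,y) ∈ ℝ^l × ℝ^m and every pair of tangent vectors ξ, η of the torus ψ at (x,y) (i.e., ξ and η are real linear combinations of the partial derivatives ∂ψ/∂x_1, …, ∂ψ/∂x_l, ∂ψ/∂y_1, …, ∂ψ/∂y_m evaluated at (x,y)), the j-component of the quaternionic Hermitian product Σ_{d=1}^n ξ_d · conj(η_d) is zero; equivalently Σ_{d=1}^n Re(j · ξ_d · conj(η_d)) = 0. (This is the ω_J-isotropy of the torus T^{l,m}, where the complex structure J is left multiplication by j.) -/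
open scoped Quaternion
open Matrix

noncomputable section

/-- `exp(t·j) = cos t + (sin t)·j` -/
def expJ (t : ℝ) : ℍ[ℝ] := ⟨Real.cos t, 0, Real.sin t, 0⟩
/-- `exp(t·k) = cos t + (sin t)·k` -/
def expK (t : ℝ) : ℍ[ℝ] := ⟨Real.cos t, 0, 0, Real.sin t⟩
def qi : ℍ[ℝ] := ⟨0, 1, 0, 0⟩
def qj : ℍ[ℝ] := ⟨0, 0, 1, 0⟩
def qk : ℍ[ℝ] := ⟨0, 0, 0, 1⟩

variable {n l m : ℕ}

/-- the torus map ψ -/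
def psi (r : Fin n → ℝ) (e : Fin n → Fin l → ℝ) (f : Fin n → Fin m → ℝ)
    (x : Fin l → ℝ) (y : Fin m → ℝ) (d : Fin n) : ℍ[ℝ] :=
  ((r d : ℝ) : ℍ[ℝ]) * expJ (∑ i, e d i * x i) * expK (∑ i, f d i * y i)

/-- ∂ψ/∂x_p -/
def dpsiX (r : Fin n → ℝ) (e : Fin n → Fin l → ℝ) (f : Fin n → Fin m → ℝ)
    (x : Fin l → ℝ) (y : Fin m → ℝ) (p : Fin l) (d : Fin n) : ℍ[ℝ] :=
  ((r d * e d p : ℝ) : ℍ[ℝ]) * (qj * expJ (∑ i, e d i * x i) * expK (∑ i, f d i * y i))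

/-- ∂ψ/∂y_q -/
def dpsiY (r : Fin n → ℝ) (e : Fin n → Fin l → ℝ) (f : Fin n → Fin m → ℝ)
    (x : Fin l → ℝ) (y : Fin m → ℝ) (q : Fin m) (d : Fin n) : ℍ[ℝ] :=
  ((r d * f d q : ℝ) : ℍ[ℝ]) * (expJ (∑ i, e d i * x i) * (qk * expK (∑ i, f d i * y i)))

/-- the tangent space of the torus at the point ψ(x,y): the real span of the partials -/
def tangentSpan (r : Fin n → ℝ) (e : Fin n → Fin l → ℝ) (f : Fin n → Fin m → ℝ)
    (x : Fin l → ℝ) (y : Fin m → ℝ) : Submodule ℝ (Fin n → ℍ[ℝ]) :=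
  Submodule.span ℝ (Set.range (Sum.elim (dpsiX r e f x y) (dpsiY r e f x y)))

/-- the block G₁ of the induced metric -/
def G1 (r : Fin n → ℝ) (e : Fin n → Fin l → ℝ) : Matrix (Fin l) (Fin l) ℝ :=
  ∑ d, (r d) ^ 2 • Matrix.vecMulVec (e d) (e d)

/-- the block G₂ of the induced metric -/
def G2 (r : Fin n → ℝ) (f : Fin n → Fin m → ℝ) : Matrix (Fin m) (Fin m) ℝ :=
  ∑ d, (r d) ^ 2 • Matrix.vecMulVec (f d) (f d)

/-- α_d = ⟨G₁⁻¹ e_d, e_d⟩ + ⟨G₂⁻¹ f_d, f_d⟩ -/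
def alpha (r : Fin n → ℝ) (e : Fin n → Fin l → ℝ) (f : Fin n → Fin m → ℝ) (d : Fin n) : ℝ :=
  (G1 r e)⁻¹ *ᵥ e d ⬝ᵥ e d + (G2 r f)⁻¹ *ᵥ f d ⬝ᵥ f d

/-- ∂²ψ/∂x_p∂x_q -/
def d2psiXX (r : Fin n → ℝ) (e : Fin n → Fin l → ℝ) (f : Fin n → Fin m → ℝ)
    (x : Fin l → ℝ) (y : Fin m → ℝ) (p q : Fin l) (d : Fin n) : ℍ[ℝ] :=
  ((r d * (e d p * e d q) : ℝ) : ℍ[ℝ]) *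
    (qj * qj * expJ (∑ i, e d i * x i) * expK (∑ i, f d i * y i))

/-- ∂²ψ/∂y_r∂y_s -/
def d2psiYY (r : Fin n → ℝ) (e : Fin n → Fin l → ℝ) (f : Fin n → Fin m → ℝ)
    (x : Fin l → ℝ) (y : Fin m → ℝ) (p q : Fin m) (d : Fin n) : ℍ[ℝ] :=
  ((r d * (f d p * f d q) : ℝ) : ℍ[ℝ]) *
    (expJ (∑ i, e d i * x i) * (qk * qk * expK (∑ i, f d i * y i)))

/-- the Laplace–Beltrami operator of the flat torus applied to ψ -/
def lap (r : Fin n → ℝ) (e : Fin n → Fin l → ℝ) (f : Fin n → Fin m → ℝ)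
    (x : Fin l → ℝ) (y : Fin m → ℝ) (d : Fin n) : ℍ[ℝ] :=
  (∑ p, ∑ q, (G1 r e)⁻¹ p q • d2psiXX r e f x y p q d) +
  (∑ p, ∑ q, (G2 r f)⁻¹ p q • d2psiYY r e f x y p q d)

/-- rk_ℤ⟨v_1, …, v_n⟩ : rank of the additive subgroup generated by the `v d` -/
def zrank {k : ℕ} (v : Fin n → (Fin k → ℝ)) : ℕ :=
  Module.finrank ℤ (Submodule.span ℤ (Set.range v))


@[simp] lemma expJ_re (t : ℝ) : (expJ t).re = Real.cos t := rfl
@[simp] lemma expJ_imI (t : ℝ) : (expJ t).imI = 0 := rfl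
@[simp] lemma expJ_imJ (t : ℝ) : (expJ t).imJ = Real.sin t := rfl
@[simp] lemma expJ_imK (t : ℝ) : (expJ t).imK = 0 := rfl

@[simp] lemma expK_re (t : ℝ) : (expK t).re = Real.cos t := rfl
@[simp] lemma expK_imI (t : ℝ) : (expK t).imI = 0 := rfl
@[simp] lemma expK_imJ (t : ℝ) : (expK t).imJ = 0 := rfl
@[simp] lemma expK_imK (t : ℝ) : (expK t).imK = Real.sin t := rfl

@[simp] lemma qj_re : qj.re = 0 := rfl
@[simp] lemma qj_imI : qj.imI = 0 := rfl
@[simp] lemma qj_imJ : qj.imJ = 1 := rfl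
@[simp] lemma qj_imK : qj.imK = 0 := rfl

@[simp] lemma qk_re : qk.re = 0 := rfl
@[simp] lemma qk_imI : qk.imI = 0 := rfl
@[simp] lemma qk_imJ : qk.imJ = 0 := rfl
@[simp] lemma qk_imK : qk.imK = 1 := rfl

/-- Every tangent vector of the torus is, in each coordinate, of the form
`exp(a·j) · (α·j + β·k) · exp(b·k)`. -/
lemma exists_eq_of_mem_tangentSpan {n l m : ℕ} {r : Fin n → ℝ}
    {e : Fin n → Fin l → ℝ} {f : Fin n → Fin m → ℝ}
    {x : Fin l → ℝ} {y : Fin m → ℝ} {ξ : Fin n → ℍ[ℝ]}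
    (hξ : ξ ∈ tangentSpan r e f x y) (d : Fin n) :
    ∃ α β : ℝ, ξ d =
      expJ (∑ i, e d i * x i) * (α • qj + β • qk) * expK (∑ i, f d i * y i) := by
  induction hξ using Submodule.span_induction with
  | mem v hv =>
    obtain ⟨p | q, rfl⟩ := hv
    · refine ⟨r d * e d p, 0, ?_⟩
      ext <;> simp [dpsiX]
    · refine ⟨0, r d * f d q, ?_⟩
      ext <;> simp [dpsiY]
  | zero => exact ⟨0, 0, by ext <;> simp⟩
  | add v w _ _ hv hw =>
    obtain ⟨α, β, h⟩ := hv
    obtain ⟨γ, δ, h'⟩ := hw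
    refine ⟨α + γ, β + δ, ?_⟩
    rw [Pi.add_apply, h, h']
    ext <;> simp <;> ring
  | smul c v _ hv =>
    obtain ⟨α, β, h⟩ := hv
    refine ⟨c * α, c * β, ?_⟩
    rw [Pi.smul_apply, h]
    ext <;> simp <;> ring

/-- ω_J-isotropy of the torus T^{l,m}: for tangent vectors ξ, η at any
point, the j-component of Σ_d ξ_d · conj(η_d) vanishes, i.e. Σ_d Re(j·ξ_d·conj(η_d)) = 0. -/
theorem stmt0 (n l m : ℕ) (hn : 1 ≤ n) (hl : 1 ≤ l) (hm : 1 ≤ m)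
    (r : Fin n → ℝ) (hr : ∀ d, 0 < r d)
    (e : Fin n → Fin l → ℝ) (f : Fin n → Fin m → ℝ)
    (x : Fin l → ℝ) (y : Fin m → ℝ)
    (ξ η : Fin n → ℍ[ℝ])
    (hξ : ξ ∈ tangentSpan r e f x y) (hη : η ∈ tangentSpan r e f x y) :
    ∑ d, (qj * ξ d * star (η d)).re = 0 := by
  refine Finset.sum_eq_zero fun d _ => ?_
  obtain ⟨α, β, h⟩ := exists_eq_of_mem_tangentSpan hξ d
  obtain ⟨γ, δ, h'⟩ := exists_eq_of_mem_tangentSpan hη d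
  rw [h, h']
  simp
  ring

end
end

section
/- For every point (x,y) ∈ ℝ^l × ℝ^m and all indices p ∈ {1,…,l}, q ∈ {1,…,m}, the value of the Kähler form associated with left multiplication by i on the mixed pair of tangent vectors of ψ is Σ_{d=1}^n Re(i · (∂ψ/∂x_p)_d · conj((∂ψ/∂y_q)_d)) = Σ_{d=1}^n r_d² (e_d)_p (f_d)_q cos(2⟨e_d,x⟩). In particular, at x = 0 this value equals Σ_{d=1}^n r_d² (e_d)_p (f_d)_q, so the torus fails to be ω_I-isotropic whenever Σ_{d=1}^n r_d² (e_d)_p (f_d)_q ≠ 0 for some p, q. -/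
open scoped Quaternion
open Matrix

noncomputable section

variable {n l m : ℕ}

/-- the summand of ω_I on a mixed pair of tangent vectors -/
theorem re_qi_mul_dpsiX_mul_star_dpsiY {n l m : ℕ} (r : Fin n → ℝ) (e : Fin n → Fin l → ℝ)
    (f : Fin n → Fin m → ℝ) (x : Fin l → ℝ) (y : Fin m → ℝ) (p : Fin l) (q : Fin m) (d : Fin n) :
    (qi * dpsiX r e f x y p d * star (dpsiY r e f x y q d)).re
      = r d ^ 2 * e d p * f d q * Real.cos (2 * ∑ i, e d i * x i) := by
  have hφ := Real.sin_sq_add_cos_sq (∑ i, f d i * y i)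
  rw [Real.cos_two_mul']
  simp only [dpsiX, dpsiY]
  generalize (∑ i, e d i * x i) = θ
  generalize (∑ i, f d i * y i) = φ at *
  simp only [Quaternion.re_mul, Quaternion.imI_mul, Quaternion.imJ_mul, Quaternion.imK_mul,
    Quaternion.re_star, Quaternion.imI_star, Quaternion.imJ_star, Quaternion.imK_star,
    Quaternion.re_coe, Quaternion.imI_coe, Quaternion.imJ_coe, Quaternion.imK_coe]
  simp only [qi, qj, qk, expJ, expK]
  linear_combination
    (r d ^ 2 * e d p * f d q * (Real.cos θ ^ 2 - Real.sin θ ^ 2)) * hφ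

/-- the value of ω_I on the mixed pair of tangent vectors of ψ, its value
at x = 0, and the resulting failure of ω_I-isotropy when Σ_d r_d² (e_d)_p (f_d)_q ≠ 0. -/
theorem stmt2 (n l m : ℕ) (hn : 1 ≤ n) (hl : 1 ≤ l) (hm : 1 ≤ m)
    (r : Fin n → ℝ) (hr : ∀ d, 0 < r d)
    (e : Fin n → Fin l → ℝ) (f : Fin n → Fin m → ℝ) :
    (∀ (x : Fin l → ℝ) (y : Fin m → ℝ) (p : Fin l) (q : Fin m),
        ∑ d, (qi * dpsiX r e f x y p d * star (dpsiY r e f x y q d)).re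
          = ∑ d, r d ^ 2 * e d p * f d q * Real.cos (2 * ∑ i, e d i * x i)) ∧
    (∀ (y : Fin m → ℝ) (p : Fin l) (q : Fin m),
        ∑ d, (qi * dpsiX r e f 0 y p d * star (dpsiY r e f 0 y q d)).re
          = ∑ d, r d ^ 2 * e d p * f d q) ∧
    ((∃ (p : Fin l) (q : Fin m), ∑ d, r d ^ 2 * e d p * f d q ≠ 0) →
      ∃ (x : Fin l → ℝ) (y : Fin m → ℝ) (p : Fin l) (q : Fin m),
        ∑ d, (qi * dpsiX r e f x y p d * star (dpsiY r e f x y q d)).re ≠ 0) := by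
  have mixed : ∀ (x : Fin l → ℝ) (y : Fin m → ℝ) (p : Fin l) (q : Fin m),
      ∑ d, (qi * dpsiX r e f x y p d * star (dpsiY r e f x y q d)).re
        = ∑ d, r d ^ 2 * e d p * f d q * Real.cos (2 * ∑ i, e d i * x i) :=
    fun x y p q => Finset.sum_congr rfl fun d _ => re_qi_mul_dpsiX_mul_star_dpsiY r e f x y p q d
  have mixed_zero : ∀ (y : Fin m → ℝ) (p : Fin l) (q : Fin m),
      ∑ d, (qi * dpsiX r e f 0 y p d * star (dpsiY r e f 0 y q d)).re
        = ∑ d, r d ^ 2 * e d p * f d q := by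
    intro y p q
    rw [mixed 0 y p q]
    simp
  refine ⟨mixed, mixed_zero, ?_⟩
  rintro ⟨p, q, h⟩
  exact ⟨0, 0, p, q, by rwa [mixed_zero]⟩

end
end

section
/- The induced metric of the torus ψ in the coordinates (x,y) is constant and block diagonal: for every point (x,y) ∈ ℝ^l × ℝ^m and all indices p, q ∈ {1,…,l}, r, s ∈ {1,…,m}, one has (∂ψ/∂x_p, ∂ψ/∂x_q) = Σ_{d=1}^n r_d² (e_d)_p (e_d)_q, (∂ψ/∂y_r, ∂ψ/∂y_s) = Σ_{d=1}^n r_d² (f_d)_r (f_d)_s, and (∂ψ/∂x_p, ∂ψ/∂y_r) = 0, where (u,v) = Σ_d Re(u_d · conj(v_d)) is the real inner product on ℍ^n. -/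
open scoped Quaternion
open Matrix

noncomputable section

variable {n l m : ℕ}

theorem re_coe_mul_mul_star (a b : ℝ) (u v : ℍ[ℝ]) :
    ((a : ℍ[ℝ]) * u * star ((b : ℍ[ℝ]) * v)).re = a * b * (u * star v).re := by
  simp
  ring

theorem re_qj_mul_expJ_mul_expK_mul_star_self (s t : ℝ) :
    (qj * expJ s * expK t * star (qj * expJ s * expK t)).re = 1 := by
  simp only [Quaternion.re_mul, Quaternion.imI_mul, Quaternion.imJ_mul, Quaternion.imK_mul,
    Quaternion.re_star, Quaternion.imI_star, Quaternion.imJ_star, Quaternion.imK_star]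
  simp only [qj, expJ, expK]
  linear_combination (Real.cos s ^ 2 + Real.sin s ^ 2) * Real.sin_sq_add_cos_sq t +
    Real.sin_sq_add_cos_sq s

theorem re_expJ_mul_qk_mul_expK_mul_star_self (s t : ℝ) :
    (expJ s * (qk * expK t) * star (expJ s * (qk * expK t))).re = 1 := by
  simp only [Quaternion.re_mul, Quaternion.imI_mul, Quaternion.imJ_mul, Quaternion.imK_mul,
    Quaternion.re_star, Quaternion.imI_star, Quaternion.imJ_star, Quaternion.imK_star]
  simp only [qk, expJ, expK]
  linear_combination (Real.cos s ^ 2 + Real.sin s ^ 2) * Real.sin_sq_add_cos_sq t +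
    Real.sin_sq_add_cos_sq s

theorem re_qj_mul_expJ_mul_expK_mul_star_expJ_mul_qk_mul_expK (s t : ℝ) :
    (qj * expJ s * expK t * star (expJ s * (qk * expK t))).re = 0 := by
  simp only [Quaternion.re_mul, Quaternion.imI_mul, Quaternion.imJ_mul, Quaternion.imK_mul,
    Quaternion.re_star, Quaternion.imI_star, Quaternion.imJ_star, Quaternion.imK_star]
  simp only [qj, qk, expJ, expK]
  ring

/-- the induced metric of ψ in the coordinates (x,y) is constant and
block diagonal. -/
theorem stmt3 (n l m : ℕ) (hn : 1 ≤ n) (hl : 1 ≤ l) (hm : 1 ≤ m)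
    (r : Fin n → ℝ) (hr : ∀ d, 0 < r d)
    (e : Fin n → Fin l → ℝ) (f : Fin n → Fin m → ℝ) :
    (∀ (x : Fin l → ℝ) (y : Fin m → ℝ) (p q : Fin l),
        ∑ d, (dpsiX r e f x y p d * star (dpsiX r e f x y q d)).re
          = ∑ d, r d ^ 2 * e d p * e d q) ∧
    (∀ (x : Fin l → ℝ) (y : Fin m → ℝ) (p q : Fin m),
        ∑ d, (dpsiY r e f x y p d * star (dpsiY r e f x y q d)).re
          = ∑ d, r d ^ 2 * f d p * f d q) ∧
    (∀ (x : Fin l → ℝ) (y : Fin m → ℝ) (p : Fin l) (q : Fin m),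
        ∑ d, (dpsiX r e f x y p d * star (dpsiY r e f x y q d)).re = 0) := by
  refine ⟨fun x y p q => Finset.sum_congr rfl fun d _ => ?_,
    fun x y p q => Finset.sum_congr rfl fun d _ => ?_,
    fun x y p q => Finset.sum_eq_zero fun d _ => ?_⟩
  · rw [dpsiX, dpsiX, re_coe_mul_mul_star, re_qj_mul_expJ_mul_expK_mul_star_self]
    ring
  · rw [dpsiY, dpsiY, re_coe_mul_mul_star, re_expJ_mul_qk_mul_expK_mul_star_self]
    ring
  · rw [dpsiX, dpsiY, re_coe_mul_mul_star,
      re_qj_mul_expJ_mul_expK_mul_star_expJ_mul_qk_mul_expK, mul_zero]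

end
end

section
/- Assume e_1, …, e_n span ℝ^l and f_1, …, f_n span ℝ^m (and r_d > 0 for all d). Then ψ is an immersion: at every point (x,y) ∈ ℝ^l × ℝ^m the l + m vectors ∂ψ/∂x_1, …, ∂ψ/∂x_l, ∂ψ/∂y_1, …, ∂ψ/∂y_m ∈ ℍ^n are linearly independent over ℝ (equivalently, the differential of ψ at (x,y) is injective). -/
open scoped Quaternion
open Matrix

noncomputable section

variable {n l m : ℕ}

lemma expK_ne_zero (t : ℝ) : expK t ≠ 0 := by
  intro h
  have h_re : Real.cos t = 0 := congrArg QuaternionAlgebra.re h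
  have h_imK : Real.sin t = 0 := congrArg QuaternionAlgebra.imK h
  simpa [h_re, h_imK] using Real.sin_sq_add_cos_sq t

lemma smul_qj_mul_expJ_add_smul_expJ_mul_qk (a b s : ℝ) :
    a • (qj * expJ s) + b • (expJ s * qk) =
      (⟨-(a * Real.sin s), b * Real.sin s, a * Real.cos s, b * Real.cos s⟩ : ℍ[ℝ]) := by
  ext <;>
    simp only [Quaternion.re_add, Quaternion.imI_add, Quaternion.imJ_add, Quaternion.imK_add,
      Quaternion.re_smul, Quaternion.imI_smul, Quaternion.imJ_smul, Quaternion.imK_smul,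
      Quaternion.re_mul, Quaternion.imI_mul, Quaternion.imJ_mul, Quaternion.imK_mul] <;>
    simp [qj, qk, expJ]

lemma eq_zero_of_smul_add_smul_eq_zero {a b s t : ℝ}
    (h : a • (qj * expJ s * expK t) + b • (expJ s * (qk * expK t)) = 0) : a = 0 ∧ b = 0 := by
  rw [← mul_assoc, ← smul_mul_assoc a (qj * expJ s), ← smul_mul_assoc b (expJ s * qk), ← add_mul,
    mul_eq_zero_iff_right (expK_ne_zero t), smul_qj_mul_expJ_add_smul_expJ_mul_qk] at h
  have h_re : -(a * Real.sin s) = 0 := congrArg QuaternionAlgebra.re h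
  have h_imI : b * Real.sin s = 0 := congrArg QuaternionAlgebra.imI h
  have h_imJ : a * Real.cos s = 0 := congrArg QuaternionAlgebra.imJ h
  have h_imK : b * Real.cos s = 0 := congrArg QuaternionAlgebra.imK h
  have h_one := Real.sin_sq_add_cos_sq s
  constructor
  · linear_combination (-a) * h_one - Real.sin s * h_re + Real.cos s * h_imJ
  · linear_combination (-b) * h_one + Real.sin s * h_imI + Real.cos s * h_imK

lemma eq_zero_of_forall_dotProduct_eq_zero {ι κ : Type*} [Fintype κ] {v : ι → κ → ℝ}
    (hv : Submodule.span ℝ (Set.range v) = ⊤) {g : κ → ℝ} (h : ∀ i, g ⬝ᵥ v i = 0) : g = 0 := by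
  have h_lin : dotProductBilin ℝ ℝ g = 0 :=
    LinearMap.ext_on_range hv fun i => h i
  exact dotProduct_eq_zero g fun w => LinearMap.congr_fun h_lin w

/-- under the spanning assumptions ψ is an immersion: at every point the
l + m partial derivatives are linearly independent over ℝ. -/
theorem stmt4 (n l m : ℕ) (hn : 1 ≤ n) (hl : 1 ≤ l) (hm : 1 ≤ m)
    (r : Fin n → ℝ) (hr : ∀ d, 0 < r d)
    (e : Fin n → Fin l → ℝ) (f : Fin n → Fin m → ℝ)
    (hspanE : Submodule.span ℝ (Set.range e) = ⊤)
    (hspanF : Submodule.span ℝ (Set.range f) = ⊤)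
    (x : Fin l → ℝ) (y : Fin m → ℝ) :
    LinearIndependent ℝ (Sum.elim (dpsiX r e f x y) (dpsiY r e f x y)) := by
  rw [Fintype.linearIndependent_iff]
  intro g hg
  have h_coeff (d : Fin n) :
      (g ∘ Sum.inl) ⬝ᵥ e d = 0 ∧ (g ∘ Sum.inr) ⬝ᵥ f d = 0 := by
    have hd := congrFun hg d
    simp only [Fintype.sum_sum_type, Sum.elim_inl, Sum.elim_inr, Finset.sum_apply,
      Pi.smul_apply, dpsiX, dpsiY, Quaternion.coe_mul_eq_smul, smul_smul, ← Finset.sum_smul,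
      Pi.zero_apply] at hd
    have h_factor {κ : Type} [Fintype κ] (c v : κ → ℝ) :
        ∑ i, c i * (r d * v i) = r d * (c ⬝ᵥ v) := by
      simp only [dotProduct, Finset.mul_sum]
      exact Finset.sum_congr rfl fun i _ => by ring
    obtain ⟨hE, hF⟩ := eq_zero_of_smul_add_smul_eq_zero hd
    exact ⟨(mul_eq_zero_iff_left (hr d).ne').1 ((h_factor _ _).symm.trans hE),
      (mul_eq_zero_iff_left (hr d).ne').1 ((h_factor _ _).symm.trans hF)⟩
  have hE := eq_zero_of_forall_dotProduct_eq_zero hspanE fun d => (h_coeff d).1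
  have hF := eq_zero_of_forall_dotProduct_eq_zero hspanF fun d => (h_coeff d).2
  rintro (p | q)
  · exact congrFun hE p
  · exact congrFun hF q

end
end

section
/- Let e_1, …, e_n ∈ ℝ^l span ℝ^l and generate a discrete additive subgroup of ℝ^l (i.e., they generate a lattice of maximal rank l), and let c_1, …, c_n ∈ ℝ. Then there exists λ ∈ ℝ^l with ⟨λ, e_d⟩ = c_d for all d = 1, …, n if and only if the additive subgroup of ℝ^{l+1} generated by the vectors e'_d := (e_d; c_d), d = 1, …, n, is a free abelian group of rank l (i.e., rk_ℤ⟨e'_1, …, e'_n⟩ = l). -/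
open scoped Quaternion
open Matrix

noncomputable section

variable {n l m : ℕ}

/-- A `ℤ`-linear surjection between finitely generated groups of the same rank is injective
when its source is torsion-free. -/
theorem injective_of_surjective_of_finrank_eq {M N : Type*} [AddCommGroup M] [AddCommGroup N]
    [Module.Finite ℤ M] [Module.IsTorsionFree ℤ M] (f : M →ₗ[ℤ] N)
    (hf : Function.Surjective f) (h : Module.finrank ℤ M = Module.finrank ℤ N) :
    Function.Injective f := by
  have h1 := Submodule.finrank_quotient_add_finrank (LinearMap.ker f)
  rw [(f.quotKerEquivOfSurjective hf).finrank_eq] at h1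
  rw [← LinearMap.ker_eq_bot, ← Submodule.finrank_eq_zero (R := ℤ)]
  omega

/-- Every additive map from a full lattice to `ℝ` extends to a real linear form. -/
theorem exists_linearMap_extending_of_isZLattice {E : Type*} [NormedAddCommGroup E]
    [NormedSpace ℝ E] [FiniteDimensional ℝ E] (L : Submodule ℤ E) [DiscreteTopology L]
    [IsZLattice ℝ L] (g : L →ₗ[ℤ] ℝ) : ∃ φ : E →ₗ[ℝ] ℝ, ∀ x : L, φ x = g x := by
  let b := Module.Free.chooseBasis ℤ L
  let φ := (b.ofZLatticeBasis ℝ L).constr ℝ fun i => g (b i)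
  refine ⟨φ, fun x => ?_⟩
  have h : (φ.restrictScalars ℤ).comp L.subtype = g := by
    refine b.ext fun i => ?_
    have := (b.ofZLatticeBasis ℝ L).constr_basis ℝ (fun i => g (b i)) i
    rw [Module.Basis.ofZLatticeBasis_apply] at this
    exact this
  exact DFunLike.congr_fun h x

/-- the lattice criterion: ∃ λ with ⟨λ, e_d⟩ = c_d for all d iff the additive
subgroup generated by the vectors e'_d = (e_d; c_d) has rank l. -/
theorem stmt8 (n l : ℕ) (hn : 1 ≤ n) (hl : 1 ≤ l)
    (e : Fin n → Fin l → ℝ) (c : Fin n → ℝ)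
    (hspan : Submodule.span ℝ (Set.range e) = ⊤)
    (hdisc : DiscreteTopology ↥(AddSubgroup.closure (Set.range e))) :
    (∃ lam : Fin l → ℝ, ∀ d, ∑ i, lam i * e d i = c d) ↔
      zrank (fun d => Fin.snoc (e d) (c d)) = l := by
  set L := Submodule.span ℤ (Set.range e) with hL
  have hdiscL : DiscreteTopology L := by
    have h : L.toAddSubgroup = AddSubgroup.closure (Set.range e) :=
      Submodule.span_int_eq_addSubgroupClosure _
    rw [← h] at hdisc
    exact hdisc
  have hlat : IsZLattice ℝ L := ⟨by rw [hL, Submodule.span_span_of_tower, hspan]⟩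
  have hrank : Module.finrank ℤ L = l := by
    rw [ZLattice.rank ℝ L, Module.finrank_fin_fun]
  set e' : Fin n → Fin (l + 1) → ℝ := fun d => Fin.snoc (e d) (c d) with he'
  set L' := Submodule.span ℤ (Set.range e') with hL'
  change _ ↔ Module.finrank ℤ L' = l
  let pr : (Fin (l + 1) → ℝ) →ₗ[ℤ] (Fin l → ℝ) := LinearMap.funLeft ℤ ℝ Fin.castSucc
  have hpr : ∀ d, pr (e' d) = e d := fun d => by
    ext i
    simp [pr, e', LinearMap.funLeft_apply]
  have hmap : L'.map pr = L := by
    rw [hL', Submodule.map_span, ← Set.range_comp]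
    exact congrArg (fun v => Submodule.span ℤ (Set.range v)) (funext hpr)
  have he'mem : ∀ d, e' d ∈ L' := fun d => Submodule.subset_span ⟨d, rfl⟩
  constructor
  · rintro ⟨lam, hlam⟩
    have hlast : ∀ x ∈ L', ∑ i, lam i * pr x i = x (Fin.last l) := by
      intro x hx
      induction hx using Submodule.span_induction with
      | mem x hx =>
        obtain ⟨d, rfl⟩ := hx
        rw [hpr, hlam]
        simp [e']
      | zero => simp
      | add x y _ _ hx hy => simp [mul_add, Finset.sum_add_distrib, hx, hy]
      | smul a x _ hx =>
        simp only [map_smul, Pi.smul_apply, ← hx, Finset.smul_sum, mul_smul_comm]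
    have hinj : Function.Injective (pr.domRestrict L') := by
      intro x y hxy
      have hxy' : pr x = pr y := hxy
      ext i
      refine Fin.lastCases ?_ (fun j => ?_) i
      · rw [← hlast x x.2, ← hlast y y.2, hxy']
      · exact congrFun hxy' j
    have := LinearMap.finrank_range_of_inj hinj
    rw [← this, LinearMap.range_domRestrict, hmap, hrank]
  · intro h
    have : Module.Finite ℤ L' := Module.Finite.span_of_finite ℤ (Set.finite_range e')
    let p : L' →ₗ[ℤ] L := pr.restrict fun x hx => hmap ▸ Submodule.mem_map_of_mem hx
    have hsurj : Function.Surjective p := by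
      rintro ⟨y, hy⟩
      rw [← hmap] at hy
      obtain ⟨x, hx, rfl⟩ := hy
      exact ⟨⟨x, hx⟩, rfl⟩
    have hinj := injective_of_surjective_of_finrank_eq p hsurj (h.trans hrank.symm)
    let σ := LinearEquiv.ofBijective p ⟨hinj, hsurj⟩
    let last : L' →ₗ[ℤ] ℝ := (LinearMap.proj (Fin.last l)).comp L'.subtype
    obtain ⟨φ, hφ⟩ := exists_linearMap_extending_of_isZLattice L (last.comp σ.symm.toLinearMap)
    refine ⟨fun i => φ (Pi.single i 1), fun d => ?_⟩
    have h1 : φ (e d) = c d := by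
      have h2 := hφ (σ ⟨e' d, he'mem d⟩)
      have h3 : ((σ ⟨e' d, he'mem d⟩ : L) : Fin l → ℝ) = e d := hpr d
      rw [h3] at h2
      rw [h2]
      simp [last, e']
    rw [← h1, LinearMap.pi_apply_eq_sum_univ φ (e d)]
    refine Finset.sum_congr rfl fun i _ => ?_
    have hsingle : (Pi.single i 1 : Fin l → ℝ) = fun j => if i = j then 1 else 0 := by
      funext j
      simp [Pi.single_apply, eq_comm]
    simp only [hsingle, smul_eq_mul, mul_comm]

end
end

section
/- Assume r_d > 0 for all d, that e_1, …, e_n span ℝ^l and generate a discrete additive subgroup of ℝ^l (a lattice of maximal rank), and that f_1, …, f_n span ℝ^m. Let H : ℝ^l × ℝ^m → ℍ^n be the mean curvature field of the torus, H_d(x,y) = −(1/(l+m)) α_d ψ_d(x,y). Then the vector field J H, given componentwise by left multiplication, (JH)_d = j · H_d, is tangent to the torus — i.e., for every (x,y), j·H(x,y) lies in the real span of ∂ψ/∂x_1, …, ∂ψ/∂x_l, ∂ψ/∂y_1, …, ∂ψ/∂y_m at (x,y) — if and only if rk_ℤ⟨e'_1, …, e'_n⟩ = l, where e'_d := (e_d;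 α_d) ∈ ℝ^{l+1}. -/
open scoped Quaternion
open Matrix

noncomputable section

variable {n l m : ℕ}

/-- A submodule of finite rank of a torsion-free module has the same rank as its image under a
linear map iff the map is injective on it. -/
theorem finrank_map_eq_iff_disjoint_ker {V W : Type*} [AddCommGroup V] [AddCommGroup W]
    [Module.IsTorsionFree ℤ V] (p : V →ₗ[ℤ] W) (S : Submodule ℤ V) [Module.Finite ℤ S] :
    Module.finrank ℤ (S.map p) = Module.finrank ℤ S ↔ Disjoint S (LinearMap.ker p) := by
  have hrange : LinearMap.range (p.domRestrict S) = S.map p := LinearMap.range_domRestrict S p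
  have hadd := (LinearMap.ker (p.domRestrict S)).finrank_quotient_add_finrank
  rw [(p.domRestrict S).quotKerEquivRange.finrank_eq, hrange] at hadd
  rw [← LinearMap.injective_domRestrict_iff, ← LinearMap.ker_eq_bot,
    ← Submodule.finrank_eq_zero (R := ℤ)]
  omega

/-- An additive function on a lattice extends to a linear form on the ambient space. -/
theorem exists_linearMap_eq_on_lattice {V : Type*} [NormedAddCommGroup V] [NormedSpace ℝ V]
    [FiniteDimensional ℝ V] (L : Submodule ℤ V) [DiscreteTopology L] [IsZLattice ℝ L]
    (g : L →ₗ[ℤ] ℝ) : ∃ φ : V →ₗ[ℝ] ℝ, ∀ v : L, φ v = g v := by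
  have : Module.Free ℤ L := ZLattice.module_free ℝ L
  let b := Module.Free.chooseBasis ℤ L
  refine ⟨(b.ofZLatticeBasis ℝ L).constr ℝ fun i => g (b i), fun v => ?_⟩
  suffices h : (((b.ofZLatticeBasis ℝ L).constr ℝ fun i => g (b i)).restrictScalars ℤ).comp
      L.subtype = g from LinearMap.congr_fun h v
  refine b.ext fun i => ?_
  have h := (b.ofZLatticeBasis ℝ L).constr_basis ℝ (fun i => g (b i)) i
  rwa [b.ofZLatticeBasis_apply ℝ L] at h

/-- Appending coordinates `a d` to generators `e d` of a full lattice preserves the `ℤ`-rank iff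
`a d` is given by a linear form evaluated at `e d`. -/
theorem zrank_snoc_eq_iff (e : Fin n → Fin l → ℝ)
    (hspan : Submodule.span ℝ (Set.range e) = ⊤)
    (hdisc : DiscreteTopology ↥(AddSubgroup.closure (Set.range e))) (a : Fin n → ℝ) :
    zrank (fun d => (Fin.snoc (e d) (a d) : Fin (l + 1) → ℝ)) = l ↔
      ∃ φ : (Fin l → ℝ) →ₗ[ℝ] ℝ, ∀ d, φ (e d) = a d := by
  set e' : Fin n → Fin (l + 1) → ℝ := fun d => Fin.snoc (e d) (a d) with he'
  set L := Submodule.span ℤ (Set.range e) with hL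
  set S := Submodule.span ℤ (Set.range e') with hS
  let p : (Fin (l + 1) → ℝ) →ₗ[ℤ] (Fin l → ℝ) := LinearMap.funLeft ℤ ℝ Fin.castSucc
  have hpe (d : Fin n) : p (e' d) = e d := by
    ext i
    simp [p, he', LinearMap.funLeft_apply]
  have hdiscL : DiscreteTopology L := by
    have h : L.toAddSubgroup = AddSubgroup.closure (Set.range e) :=
      Submodule.span_int_eq_addSubgroupClosure _
    rw [← h] at hdisc
    exact hdisc
  have hlat : IsZLattice ℝ L := ⟨by rw [hL, Submodule.span_span_of_tower, hspan]⟩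
  have hrank : Module.finrank ℤ L = l := by
    rw [ZLattice.rank ℝ L, Module.finrank_fin_fun]
  have hmap : S.map p = L := by
    rw [hS, Submodule.map_span, ← Set.range_comp, hL]
    congr 2
    exact funext hpe
  have : Module.Finite ℤ S := Module.Finite.span_of_finite ℤ (Set.finite_range e')
  have key : zrank e' = l ↔ Disjoint S (LinearMap.ker p) := by
    rw [← finrank_map_eq_iff_disjoint_ker, hmap, hrank, zrank, eq_comm]
  rw [key]
  constructor
  · intro h
    have hinj : Function.Injective (p.domRestrict S) :=
      LinearMap.injective_domRestrict_iff.mpr h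
    have hrange : LinearMap.range (p.domRestrict S) = L := by
      rw [LinearMap.range_domRestrict, hmap]
    let E : S ≃ₗ[ℤ] L := (LinearEquiv.ofInjective _ hinj).trans (LinearEquiv.ofEq _ _ hrange)
    let g : L →ₗ[ℤ] ℝ := (LinearMap.proj (Fin.last l)).comp (S.subtype.comp E.symm.toLinearMap)
    obtain ⟨φ, hφ⟩ := exists_linearMap_eq_on_lattice L g
    refine ⟨φ, fun d => ?_⟩
    have hE : E ⟨e' d, Submodule.subset_span ⟨d, rfl⟩⟩ =
        ⟨e d, Submodule.subset_span ⟨d, rfl⟩⟩ := Subtype.ext (hpe d)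
    have h := hφ ⟨e d, Submodule.subset_span ⟨d, rfl⟩⟩
    simpa [g, ← hE, he'] using h
  · rintro ⟨φ, hφ⟩
    have hle : S ≤ LinearMap.ker
        (LinearMap.proj (Fin.last l) - (φ.restrictScalars ℤ).comp p) := by
      rw [hS, Submodule.span_le]
      rintro _ ⟨d, rfl⟩
      have hlast : e' d (Fin.last l) = a d := by simp [he']
      simp [hpe, hφ, hlast]
    rw [Submodule.disjoint_def]
    intro v hv hpv
    have hlast := hle hv
    rw [LinearMap.mem_ker] at hpv hlast
    have hlast0 : v (Fin.last l) = 0 := by simpa [hpv] using hlast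
    ext i
    refine Fin.lastCases hlast0 (fun j => ?_) i
    exact congrFun hpv j

/-- Left multiplication by `j` maps the field `a d • ψ_d` to a tangent field iff `a d` is given by
a linear form evaluated at `e d`. -/
theorem qj_mul_smul_psi_mem_tangentSpan_iff (r : Fin n → ℝ) (hr : ∀ d, 0 < r d)
    (e : Fin n → Fin l → ℝ) (f : Fin n → Fin m → ℝ) (a : Fin n → ℝ) :
    (∀ x y, (fun d => qj * a d • psi r e f x y d) ∈ tangentSpan r e f x y) ↔
      ∃ φ : (Fin l → ℝ) →ₗ[ℝ] ℝ, ∀ d, φ (e d) = a d := by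
  constructor
  · intro h
    obtain ⟨c, hc⟩ := (Submodule.mem_span_range_iff_exists_fun ℝ).mp (h 0 0)
    refine ⟨∑ p, c (Sum.inl p) • LinearMap.proj p, fun d => ?_⟩
    have hd := congrArg QuaternionAlgebra.imJ (congrFun hc d)
    have hsum {ι : Type} (s : Finset ι) (q : ι → ℍ[ℝ]) :
        (∑ i ∈ s, q i).imJ = ∑ i ∈ s, (q i).imJ :=
      map_sum (QuaternionAlgebra.imJₗ (-1 : ℝ) 0 (-1)) q s
    have hJ : expJ 0 = 1 := by ext <;> simp [expJ]
    have hK : expK 0 = 1 := by ext <;> simp [expK]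
    simp only [psi, dpsiX, dpsiY, Pi.zero_apply, mul_zero, Finset.sum_const_zero, hJ, hK,
      mul_one, one_mul, Fintype.sum_sum_type, Sum.elim_inl, Sum.elim_inr, Finset.sum_apply,
      Pi.smul_apply, Quaternion.coe_mul_eq_smul] at hd
    have hqj : qj.imJ = 1 := rfl
    have hqk : qk.imJ = 0 := rfl
    simp only [mul_smul_comm, Quaternion.mul_coe_eq_smul, Quaternion.imJ_add, hsum,
      Quaternion.imJ_smul, smul_eq_mul, hqj, hqk, mul_one, mul_zero, Finset.sum_const_zero,
      add_zero] at hd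
    have : r d * ∑ p, c (Sum.inl p) * e d p = r d * a d := by
      rw [Finset.mul_sum]
      convert hd using 1
      · exact Finset.sum_congr rfl fun _ _ => by ring
      · ring
    simpa using mul_left_cancel₀ (hr d).ne' this
  · rintro ⟨φ, hφ⟩ x y
    refine (Submodule.mem_span_range_iff_exists_fun ℝ).mpr
      ⟨Sum.elim (fun p => φ (Pi.single p 1)) 0, funext fun d => ?_⟩
    have hφd : a d = ∑ p, φ (Pi.single p 1) * e d p := by
      rw [← hφ d, LinearMap.pi_apply_eq_sum_univ φ (e d)]
      exact Finset.sum_congr rfl fun _ _ => by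
        rw [smul_eq_mul, mul_comm]
        congr 2
        ext
        simp [Pi.single_apply, eq_comm]
    have hX (p : Fin l) : dpsiX r e f x y p d = e d p • (qj * psi r e f x y d) := by
      simp only [dpsiX, psi, Quaternion.coe_mul_eq_smul, mul_smul_comm, smul_mul_assoc,
        smul_smul, mul_assoc, mul_comm]
    simp only [Fintype.sum_sum_type, Sum.elim_inl, Sum.elim_inr, Pi.zero_apply, zero_smul,
      Finset.sum_const_zero, add_zero, Finset.sum_apply, Pi.smul_apply, hX, smul_smul]
    rw [← Finset.sum_smul, ← hφd, mul_smul_comm]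

/-- JH is tangent to the torus iff rk_ℤ⟨e'_1, …, e'_n⟩ = l, where
e'_d = (e_d; α_d). -/
theorem stmt9 (n l m : ℕ) (hn : 1 ≤ n) (hl : 1 ≤ l) (hm : 1 ≤ m)
    (r : Fin n → ℝ) (hr : ∀ d, 0 < r d)
    (e : Fin n → Fin l → ℝ) (f : Fin n → Fin m → ℝ)
    (hspanE : Submodule.span ℝ (Set.range e) = ⊤)
    (hdisc : DiscreteTopology ↥(AddSubgroup.closure (Set.range e)))
    (hspanF : Submodule.span ℝ (Set.range f) = ⊤)
    (H : (Fin l → ℝ) → (Fin m → ℝ) → Fin n → ℍ[ℝ])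
    (hH : ∀ x y d, H x y d = (-(1 / ((l : ℝ) + m)) * alpha r e f d) • psi r e f x y d) :
    (∀ x y, (fun d => qj * H x y d) ∈ tangentSpan r e f x y) ↔
      zrank (fun d => Fin.snoc (e d) (alpha r e f d)) = l := by
  simp only [hH]
  rw [zrank_snoc_eq_iff e hspanE hdisc, qj_mul_smul_psi_mem_tangentSpan_iff r hr]
  have hc : -(1 / ((l : ℝ) + m)) ≠ 0 := by
    have : (0 : ℝ) < l := by exact_mod_cast hl
    exact neg_ne_zero.mpr (by positivity)
  constructor
  · rintro ⟨φ, hφ⟩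
    refine ⟨(-(1 / ((l : ℝ) + m)))⁻¹ • φ, fun d => ?_⟩
    rw [LinearMap.smul_apply, hφ, smul_eq_mul, inv_mul_cancel_left₀ hc]
  · rintro ⟨φ, hφ⟩
    exact ⟨(-(1 / ((l : ℝ) + m))) • φ, fun d => by rw [LinearMap.smul_apply, hφ, smul_eq_mul]⟩

end
end

section
/- Assume r_d > 0 for all d, that f_1, …, f_n span ℝ^m and generate a discrete additive subgroup of ℝ^m (a lattice of maximal rank), and that e_1, …, e_n span ℝ^l. Let H : ℝ^l × ℝ^m → ℍ^n be the mean curvature field of the torus, H_d(x,y) = −(1/(l+m)) α_d ψ_d(x,y). Then the vector field K H, given componentwise by right multiplication, (KH)_d = H_d · k, is tangent to the torus — i.e., for every (x,y), H(x,y)·k lies in the real span of ∂ψ/∂x_1, …, ∂ψ/∂x_l, ∂ψ/∂y_1, …, ∂ψ/∂y_m at (x,y) — if and only if rk_ℤ⟨f'_1, …, f'_n⟩ = m, where f'_d := (f_d; α_d) ∈ ℝ^{m+1}. -/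
open scoped Quaternion
open Matrix

noncomputable section

variable {n l m : ℕ}

theorem exists_linear_extension_of_finrank_eq {m : ℕ} {ι : Type*} [Finite ι]
    (f : ι → Fin m → ℝ) (a : ι → ℝ)
    (hspan : Submodule.span ℝ (Set.range f) = ⊤)
    (hdisc : DiscreteTopology (AddSubgroup.closure (Set.range f)))
    (hrank : Module.finrank ℤ (Submodule.span ℤ
      (Set.range fun d => (Fin.snoc (f d) (a d) : Fin (m + 1) → ℝ))) = m) :
    ∃ g : (Fin m → ℝ) →ₗ[ℝ] ℝ, ∀ d, g (f d) = a d := by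
  set F : ι → Fin (m + 1) → ℝ := fun d => Fin.snoc (f d) (a d) with hF
  set L := Submodule.span ℤ (Set.range f) with hL
  set M := Submodule.span ℤ (Set.range F) with hM
  have : DiscreteTopology L := by
    rw [← Submodule.span_int_eq_addSubgroupClosure] at hdisc
    exact hdisc
  have : IsZLattice ℝ L := ⟨by rw [hL, Submodule.span_span_of_tower]; exact hspan⟩
  have hLfin : Module.Finite ℤ L := ZLattice.module_finite ℝ L
  have hLfree : Module.Free ℤ L := ZLattice.module_free ℝ L
  have hMfin : Module.Finite ℤ M := Module.Finite.span_of_finite ℤ (Set.finite_range F)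
  have hLrank : Module.finrank ℤ L = m := by
    rw [ZLattice.rank ℝ L]; simp
  let q : (Fin (m + 1) → ℝ) →ₗ[ℤ] (Fin m → ℝ) :=
    LinearMap.funLeft ℤ ℝ Fin.castSucc
  have hqF : ∀ d, q (F d) = f d := fun d => by
    ext i; simp [q, F, LinearMap.funLeft_apply]
  have hmap : M.map q = L := by
    rw [hM, Submodule.map_span, ← Set.range_comp, hL]
    congr 2
    ext1 d
    exact hqF d
  let p : M →ₗ[ℤ] (Fin m → ℝ) := q.domRestrict M
  have hrange : LinearMap.range p = L := by
    rw [← hmap]; exact LinearMap.range_domRestrict M q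
  have hker : LinearMap.ker p = ⊥ := by
    have h := Submodule.finrank_quotient_add_finrank (LinearMap.ker p)
    rw [p.quotKerEquivRange.finrank_eq, hrange, hLrank, hrank] at h
    exact Submodule.finrank_eq_zero.mp (by omega)
  let E : M ≃ₗ[ℤ] LinearMap.range p := LinearEquiv.ofInjective p (LinearMap.ker_eq_bot.mp hker)
  let E' : M ≃ₗ[ℤ] L := E.trans (LinearEquiv.ofEq _ _ hrange)
  have hE' : ∀ v : M, (E' v : Fin m → ℝ) = q v := fun v => rfl
  let s : L →ₗ[ℤ] ℝ :=
    (LinearMap.proj (Fin.last m) : (Fin (m + 1) → ℝ) →ₗ[ℤ] ℝ) ∘ₗ M.subtype ∘ₗ E'.symm.toLinearMap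
  let b := Module.Free.chooseBasis ℤ L
  let g := (b.ofZLatticeBasis ℝ L).constr ℝ fun i => s (b i)
  have hg : g.restrictScalars ℤ ∘ₗ L.subtype = s := by
    refine b.ext fun i => ?_
    have := (b.ofZLatticeBasis ℝ L).constr_basis ℝ (fun i => s (b i)) i
    rw [Module.Basis.ofZLatticeBasis_apply] at this
    exact this
  refine ⟨g, fun d => ?_⟩
  have hFd : F d ∈ M := Submodule.subset_span ⟨d, rfl⟩
  have hfd : f d ∈ L := Submodule.subset_span ⟨d, rfl⟩
  have hEd : E' ⟨F d, hFd⟩ = ⟨f d, hfd⟩ := Subtype.ext ((hE' _).trans (hqF d))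
  have h1 : g (f d) = s ⟨f d, hfd⟩ := LinearMap.congr_fun hg ⟨f d, hfd⟩
  rw [h1, ← hEd]
  simp [s, F]

theorem finrank_span_snoc_linear {m : ℕ} {ι : Type*}
    (f : ι → Fin m → ℝ)
    (hspan : Submodule.span ℝ (Set.range f) = ⊤)
    (hdisc : DiscreteTopology (AddSubgroup.closure (Set.range f)))
    (g : (Fin m → ℝ) →ₗ[ℝ] ℝ) :
    Module.finrank ℤ (Submodule.span ℤ
      (Set.range fun d => (Fin.snoc (f d) (g (f d)) : Fin (m + 1) → ℝ))) = m := by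
  set L := Submodule.span ℤ (Set.range f) with hL
  have : DiscreteTopology L := by
    rw [← Submodule.span_int_eq_addSubgroupClosure] at hdisc
    exact hdisc
  have : IsZLattice ℝ L := ⟨by rw [hL, Submodule.span_span_of_tower]; exact hspan⟩
  have hLrank : Module.finrank ℤ L = m := by
    rw [ZLattice.rank ℝ L]; simp
  let j : (Fin m → ℝ) →ₗ[ℤ] (Fin (m + 1) → ℝ) :=
    { toFun := fun v => Fin.snoc v (g v)
      map_add' := fun v w => by
        ext i; refine Fin.lastCases ?_ (fun i => ?_) i <;> simp
      map_smul' := fun c v => by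
        ext i; refine Fin.lastCases ?_ (fun i => ?_) i <;> simp [-zsmul_eq_mul] }
  have hj : Function.Injective j := fun v w h => by
    ext i
    simpa [j] using congr_fun h i.castSucc
  have hmap : L.map j = Submodule.span ℤ
      (Set.range fun d => (Fin.snoc (f d) (g (f d)) : Fin (m + 1) → ℝ)) := by
    rw [hL, Submodule.map_span, ← Set.range_comp]
    rfl
  rw [← hmap, ← (Submodule.equivMapOfInjective j hj L).finrank_eq, hLrank]

theorem expJ_mul_expJ_neg (t : ℝ) : expJ (-t) * expJ t = 1 := by
  ext <;> simp only [Quaternion.re_mul, Quaternion.imI_mul, Quaternion.imJ_mul,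
    Quaternion.imK_mul, Quaternion.re_one, Quaternion.imI_one, Quaternion.imJ_one,
    Quaternion.imK_one] <;> simp only [expJ, Real.cos_neg, Real.sin_neg] <;>
    grind [Real.cos_sq_add_sin_sq t]

theorem expK_mul_expK_neg (t : ℝ) : expK t * expK (-t) = 1 := by
  ext <;> simp only [Quaternion.re_mul, Quaternion.imI_mul, Quaternion.imJ_mul,
    Quaternion.imK_mul, Quaternion.re_one, Quaternion.imI_one, Quaternion.imJ_one,
    Quaternion.imK_one] <;> simp only [expK, Real.cos_neg, Real.sin_neg] <;>
    grind [Real.cos_sq_add_sin_sq t]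

theorem qj_mul_expJ (t : ℝ) : qj * expJ t = expJ t * qj := by
  ext <;> simp only [Quaternion.re_mul, Quaternion.imI_mul, Quaternion.imJ_mul,
    Quaternion.imK_mul] <;> simp [expJ, qj]

theorem expK_mul_qk (t : ℝ) : expK t * qk = qk * expK t := by
  ext <;> simp only [Quaternion.re_mul, Quaternion.imI_mul, Quaternion.imJ_mul,
    Quaternion.imK_mul] <;> simp [expK, qk]

theorem mem_tangentSpan_iff {n l m : ℕ} (r : Fin n → ℝ) (e : Fin n → Fin l → ℝ)
    (f : Fin n → Fin m → ℝ) (x : Fin l → ℝ) (y : Fin m → ℝ) (v : Fin n → ℍ[ℝ]) :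
    v ∈ tangentSpan r e f x y ↔ ∃ (a : Fin l → ℝ) (b : Fin m → ℝ), ∀ d,
      v d = expJ (∑ i, e d i * x i) *
        ((r d * ∑ p, a p * e d p) • qj + (r d * ∑ q, b q * f d q) • qk) *
          expK (∑ i, f d i * y i) := by
  have key : ∀ (a : Fin l → ℝ) (b : Fin m → ℝ) (d : Fin n),
      (∑ i, Sum.elim a b i • Sum.elim (dpsiX r e f x y) (dpsiY r e f x y) i) d =
      expJ (∑ i, e d i * x i) *
        ((r d * ∑ p, a p * e d p) • qj + (r d * ∑ q, b q * f d q) • qk) *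
          expK (∑ i, f d i * y i) := by
    intro a b d
    simp only [Fintype.sum_sum_type, Sum.elim_inl, Sum.elim_inr,
      Finset.sum_apply, Pi.smul_apply, dpsiX, dpsiY, qj_mul_expJ, Quaternion.coe_mul_eq_smul,
      mul_add, add_mul, mul_smul_comm, smul_mul_assoc, smul_smul, ← Finset.sum_smul, mul_assoc,
      Finset.mul_sum]
    congr 2 <;> exact Finset.sum_congr rfl fun _ _ => by ring
  rw [tangentSpan, Submodule.mem_span_range_iff_exists_fun]
  constructor
  · rintro ⟨c, rfl⟩
    refine ⟨c ∘ Sum.inl, c ∘ Sum.inr, fun d => ?_⟩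
    rw [← key, Sum.elim_comp_inl_inr]
  · rintro ⟨a, b, h⟩
    exact ⟨Sum.elim a b, funext fun d => (key a b d).trans (h d).symm⟩

theorem smul_psi_mul_qk_mem_tangentSpan_iff {n l m : ℕ} (r : Fin n → ℝ) (hr : ∀ d, 0 < r d)
    (e : Fin n → Fin l → ℝ) (f : Fin n → Fin m → ℝ) (x : Fin l → ℝ) (y : Fin m → ℝ)
    (c : Fin n → ℝ) :
    (fun d => c d • psi r e f x y d * qk) ∈ tangentSpan r e f x y ↔
      ∃ b : Fin m → ℝ, ∀ d, ∑ q, b q * f d q = c d := by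
  have hpsi : ∀ d, c d • psi r e f x y d * qk = expJ (∑ i, e d i * x i) *
      ((r d * c d) • qk) * expK (∑ i, f d i * y i) := fun d => by
    simp only [psi, Quaternion.coe_mul_eq_smul, smul_mul_assoc, mul_smul_comm, smul_smul,
      mul_assoc, expK_mul_qk, mul_comm (c d)]
  simp only [mem_tangentSpan_iff, hpsi]
  constructor
  · rintro ⟨a, b, h⟩
    refine ⟨b, fun d => ?_⟩
    have h' := congrArg (fun z => expJ (-∑ i, e d i * x i) * z * expK (-∑ i, f d i * y i)) (h d)
    have cancel : ∀ (s t : ℝ) (z : ℍ[ℝ]), expJ (-s) * (expJ s * z * expK t) * expK (-t) = z := by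
      intro s t z
      calc _ = (expJ (-s) * expJ s) * z * (expK t * expK (-t)) := by simp only [mul_assoc]
        _ = z := by rw [expJ_mul_expJ_neg, expK_mul_expK_neg, one_mul, mul_one]
    simp only [cancel] at h'
    have h'' : r d * c d = r d * ∑ q, b q * f d q := by
      have h₀ := congrArg (fun z : ℍ[ℝ] => z.imK) h'
      simp only [Quaternion.imK_add, Quaternion.imK_smul, smul_eq_mul] at h₀
      simpa only [qj, qk, mul_zero, mul_one, zero_add] using h₀
    exact (mul_left_cancel₀ (hr d).ne' h'').symm
  · rintro ⟨b, h⟩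
    exact ⟨0, b, fun d => by simp [h d]⟩

/-- KH is tangent to the torus iff rk_ℤ⟨f'_1, …, f'_n⟩ = m, where
f'_d = (f_d; α_d). -/
theorem stmt10 (n l m : ℕ) (hn : 1 ≤ n) (hl : 1 ≤ l) (hm : 1 ≤ m)
    (r : Fin n → ℝ) (hr : ∀ d, 0 < r d)
    (e : Fin n → Fin l → ℝ) (f : Fin n → Fin m → ℝ)
    (hspanF : Submodule.span ℝ (Set.range f) = ⊤)
    (hdisc : DiscreteTopology ↥(AddSubgroup.closure (Set.range f)))
    (hspanE : Submodule.span ℝ (Set.range e) = ⊤)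
    (H : (Fin l → ℝ) → (Fin m → ℝ) → Fin n → ℍ[ℝ])
    (hH : ∀ x y d, H x y d = (-(1 / ((l : ℝ) + m)) * alpha r e f d) • psi r e f x y d) :
    (∀ x y, (fun d => H x y d * qk) ∈ tangentSpan r e f x y) ↔
      zrank (fun d => Fin.snoc (f d) (alpha r e f d)) = m := by
  have hlm : (l : ℝ) + m ≠ 0 := by positivity
  simp only [hH, smul_psi_mul_qk_mem_tangentSpan_iff r hr e f]
  constructor
  · intro h
    obtain ⟨b, hb⟩ := h 0 0
    let g : (Fin m → ℝ) →ₗ[ℝ] ℝ := -((l : ℝ) + m) • Fintype.linearCombination ℝ b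
    have hg : ∀ d, alpha r e f d = g (f d) := fun d => by
      have : Fintype.linearCombination ℝ b (f d) = -(1 / ((l : ℝ) + m)) * alpha r e f d := by
        rw [← hb d, Fintype.linearCombination_apply]
        exact Finset.sum_congr rfl fun _ _ => mul_comm _ _
      simp only [g, LinearMap.smul_apply, this, smul_eq_mul]
      field_simp
    simp only [hg]
    exact finrank_span_snoc_linear f hspanF hdisc g
  · intro h _ _
    obtain ⟨g, hg⟩ := exists_linear_extension_of_finrank_eq f (alpha r e f) hspanF hdisc h
    refine ⟨fun q => -(1 / ((l : ℝ) + m)) * g (Pi.single q 1), fun d => ?_⟩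
    rw [← hg d, LinearMap.pi_apply_eq_sum_univ g (f d), Finset.mul_sum]
    refine Finset.sum_congr rfl fun q _ => ?_
    rw [smul_eq_mul, ← mul_assoc, mul_right_comm]
    congr 2
    ext i
    simp [Pi.single_apply, eq_comm]

end
end

section
/- For every (x,y) ∈ ℝ^l × ℝ^m and all indices p ∈ {1,…,l}, q ∈ {1,…,m}: (∂ψ/∂x_p, ψ·k)(x,y) = 0 and (∂ψ/∂y_q, ψ·k)(x,y) = Σ_{d=1}^n r_d² (f_d)_q, where ψ·k denotes componentwise right multiplication by k (the fiber direction of the corresponding Hopf action). Consequently, the torus ψ is horizontal with respect to this fibration — i.e., at every point every tangent vector of ψ is orthogonal to ψ·k — if and only if Σ_{d=1}^n r_d² f_d = 0. -/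
open scoped Quaternion
open Matrix

noncomputable section

variable {n l m : ℕ}

lemma re_inner_dpsiX (r : Fin n → ℝ) (e : Fin n → Fin l → ℝ) (f : Fin n → Fin m → ℝ)
    (x : Fin l → ℝ) (y : Fin m → ℝ) (p : Fin l) (d : Fin n) :
    (dpsiX r e f x y p d * star (psi r e f x y d * qk)).re = 0 := by
  simp [dpsiX, psi]
  ring

lemma re_inner_dpsiY (r : Fin n → ℝ) (e : Fin n → Fin l → ℝ) (f : Fin n → Fin m → ℝ)
    (x : Fin l → ℝ) (y : Fin m → ℝ) (q : Fin m) (d : Fin n) :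
    (dpsiY r e f x y q d * star (psi r e f x y d * qk)).re = r d ^ 2 * f d q := by
  have h₁ := Real.sin_sq_add_cos_sq (∑ i, e d i * x i)
  have h₂ := Real.sin_sq_add_cos_sq (∑ i, f d i * y i)
  simp only [dpsiY, psi, Quaternion.re_mul, Quaternion.imI_mul, Quaternion.imJ_mul,
    Quaternion.imK_mul, Quaternion.re_star, Quaternion.imI_star, Quaternion.imJ_star,
    Quaternion.imK_star, Quaternion.re_coe, Quaternion.imI_coe, Quaternion.imJ_coe,
    Quaternion.imK_coe, expJ_re, expJ_imI, expJ_imJ, expJ_imK, expK_re, expK_imI, expK_imJ,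
    expK_imK, qk_re, qk_imI, qk_imJ, qk_imK]
  generalize Real.sin (∑ i, e d i * x i) = s at *
  generalize Real.cos (∑ i, e d i * x i) = c at *
  generalize Real.sin (∑ i, f d i * y i) = t at *
  generalize Real.cos (∑ i, f d i * y i) = u at *
  linear_combination (r d ^ 2 * f d q * (t ^ 2 + u ^ 2)) * h₁ + r d ^ 2 * f d q * h₂

/-- (∂ψ/∂x_p, ψ·k) = 0, (∂ψ/∂y_q, ψ·k) = Σ_d r_d²(f_d)_q; hence the torus
is horizontal for the corresponding Hopf action iff Σ_d r_d² f_d = 0. -/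
theorem stmt16 (n l m : ℕ) (hn : 1 ≤ n) (hl : 1 ≤ l) (hm : 1 ≤ m)
    (r : Fin n → ℝ) (hr : ∀ d, 0 < r d)
    (e : Fin n → Fin l → ℝ) (f : Fin n → Fin m → ℝ) :
    (∀ (x : Fin l → ℝ) (y : Fin m → ℝ) (p : Fin l),
        ∑ d, (dpsiX r e f x y p d * star (psi r e f x y d * qk)).re = 0) ∧
    (∀ (x : Fin l → ℝ) (y : Fin m → ℝ) (q : Fin m),
        ∑ d, (dpsiY r e f x y q d * star (psi r e f x y d * qk)).re
          = ∑ d, r d ^ 2 * f d q) ∧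
    ((∀ (x : Fin l → ℝ) (y : Fin m → ℝ), ∀ ξ ∈ tangentSpan r e f x y,
        ∑ d, (ξ d * star (psi r e f x y d * qk)).re = 0) ↔
      ∀ q, ∑ d, r d ^ 2 * f d q = 0) := by
  have hX : ∀ (x : Fin l → ℝ) (y : Fin m → ℝ) (p : Fin l),
      ∑ d, (dpsiX r e f x y p d * star (psi r e f x y d * qk)).re = 0 := fun x y p =>
    Finset.sum_eq_zero fun d _ => re_inner_dpsiX r e f x y p d
  have hY : ∀ (x : Fin l → ℝ) (y : Fin m → ℝ) (q : Fin m),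
      ∑ d, (dpsiY r e f x y q d * star (psi r e f x y d * qk)).re
        = ∑ d, r d ^ 2 * f d q := fun x y q =>
    Finset.sum_congr rfl fun d _ => re_inner_dpsiY r e f x y q d
  refine ⟨hX, hY, fun h q => ?_, fun h x y ξ hξ => ?_⟩
  · rw [← hY 0 0 q]
    exact h 0 0 _ (Submodule.subset_span ⟨Sum.inr q, rfl⟩)
  · induction hξ using Submodule.span_induction with
    | mem v hv =>
      obtain ⟨p | q, rfl⟩ := hv
      · exact hX x y p
      · exact (hY x y q).trans (h q)
    | zero => simp
    | add u v _ _ hu hv =>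
      simp only [Pi.add_apply, add_mul, Quaternion.re_add, Finset.sum_add_distrib, hu, hv,
        add_zero]
    | smul a v _ hv =>
      simp only [Pi.smul_apply, smul_mul_assoc, Quaternion.re_smul, smul_eq_mul,
        ← Finset.mul_sum, hv, mul_zero]

end
end

section
/- Suppose l = n, the vectors e_1, …, e_n form a basis of ℝ^n, the vectors f_1, …, f_n span ℝ^m, and r_d > 0 for all d. Let H_d(x,y) = −(1/(n+m)) α_d ψ_d(x,y) be the mean curvature field of the torus T^{n,m} in ℍ^n. Then for every (x,y) ∈ ℝ^n × ℝ^m, the vector j·H(x,y) (componentwise left multiplication by j) lies in the real span of the partial derivatives ∂ψ/∂x_1, …, ∂ψ/∂x_n, ∂ψ/∂y_1, …, ∂ψ/∂y_m at (x,y). (This underlies the corollary that the torus T^{n,m} ⊂ ℍ^n is H-minimal with respect to ω_J.) -/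
open scoped Quaternion
open Matrix

noncomputable section

variable {n l m : ℕ}

theorem psi_eq_smul (r : Fin n → ℝ) (e : Fin n → Fin l → ℝ) (f : Fin n → Fin m → ℝ)
    (x : Fin l → ℝ) (y : Fin m → ℝ) (d : Fin n) :
    psi r e f x y d = r d • (expJ (∑ i, e d i * x i) * expK (∑ i, f d i * y i)) := by
  rw [psi, mul_assoc, Quaternion.coe_mul_eq_smul]

theorem dpsiX_eq_smul (r : Fin n → ℝ) (e : Fin n → Fin l → ℝ) (f : Fin n → Fin m → ℝ)
    (x : Fin l → ℝ) (y : Fin m → ℝ) (p : Fin l) (d : Fin n) :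
    dpsiX r e f x y p d = e d p • (qj * psi r e f x y d) := by
  rw [dpsiX, psi_eq_smul, Quaternion.coe_mul_eq_smul, mul_smul_comm, smul_smul, mul_assoc,
    mul_comm (r d)]

theorem dpsiX_mem_tangentSpan (r : Fin n → ℝ) (e : Fin n → Fin l → ℝ) (f : Fin n → Fin m → ℝ)
    (x : Fin l → ℝ) (y : Fin m → ℝ) (p : Fin l) :
    dpsiX r e f x y p ∈ tangentSpan r e f x y :=
  Submodule.subset_span ⟨Sum.inl p, rfl⟩

/-- When the `e d` are a basis, every real rescaling of the coordinates of `j·ψ` is tangent. -/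
theorem smul_qj_mul_psi_mem_tangentSpan (r : Fin n → ℝ) {e : Fin n → Fin n → ℝ}
    (he : LinearIndependent ℝ e) (f : Fin n → Fin m → ℝ) (x : Fin n → ℝ) (y : Fin m → ℝ)
    (β : Fin n → ℝ) :
    (fun d => β d • (qj * psi r e f x y d)) ∈ tangentSpan r e f x y := by
  have hunit : IsUnit (Matrix.of e) := Matrix.linearIndependent_rows_iff_isUnit.1 he
  obtain ⟨c, rfl⟩ := Matrix.mulVec_surjective_iff_isUnit.2 hunit β
  have hsum : (fun d => (Matrix.of e *ᵥ c) d • (qj * psi r e f x y d)) =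
      ∑ p, c p • dpsiX r e f x y p := by
    ext1 d
    simp only [Finset.sum_apply, Pi.smul_apply, dpsiX_eq_smul, smul_smul, ← Finset.sum_smul,
      Matrix.mulVec, dotProduct, Matrix.of_apply, mul_comm]
  rw [hsum]
  exact Submodule.sum_mem _ fun p _ =>
    Submodule.smul_mem _ _ (dpsiX_mem_tangentSpan r e f x y p)

/-- for l = n with e_1, …, e_n a basis of ℝ^n, the vector field JH is
tangent to the torus T^{n,m} at every point. -/
theorem stmt17 (n m : ℕ) (hn : 1 ≤ n) (hm : 1 ≤ m)
    (r : Fin n → ℝ) (hr : ∀ d, 0 < r d)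
    (e : Fin n → Fin n → ℝ) (f : Fin n → Fin m → ℝ)
    (hindep : LinearIndependent ℝ e)
    (hspanE : Submodule.span ℝ (Set.range e) = ⊤)
    (hspanF : Submodule.span ℝ (Set.range f) = ⊤)
    (H : (Fin n → ℝ) → (Fin m → ℝ) → Fin n → ℍ[ℝ])
    (hH : ∀ x y d, H x y d = (-(1 / ((n : ℝ) + m)) * alpha r e f d) • psi r e f x y d) :
    ∀ x y, (fun d => qj * H x y d) ∈ tangentSpan r e f x y := by
  intro x y
  simp only [hH, mul_smul_comm]
  exact smul_qj_mul_psi_mem_tangentSpan r hindep f x y _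

end
end
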